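/- arXiv:2002.03783 — 7 statements merged into one kernel-verified Lean document; each statement's English description precedes it below -/
import Mathlib

section
/- All solutions (n, r, x) in nonnegative integers n, r with x a positive integer of the Diophantine equation F_{n+1}^x − F_n^x = L_r are (n,r,x) = (0,1,x) for arbitrary x ≥ 1, together with (2,1,1), (2,2,2), (2,4,3), (4,0,1), (3,1,1), and (5,2,1). -/
/-- The Lucas sequence: `L 0 = 2`, `L 1 = 1`, `L (n+2) = L (n+1) + L n`. -/
def lucas : ℕ → ℕ
  | 0 => 2
  | 1 => 1
  | n + 2 => lucas (n + 1) + lucas n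

theorem lucas_add_two (n : ℕ) : lucas (n + 2) = lucas (n + 1) + lucas n := rfl

theorem lucas_pos (n : ℕ) : 0 < lucas n := by
  induction n using Nat.twoStepInduction with
  | zero => decide
  | one => decide
  | more n ih₀ ih₁ => exact Nat.add_pos_left ih₁ _

theorem le_lucas (n : ℕ) : n ≤ lucas n := by
  induction n using Nat.twoStepInduction with
  | zero => decide
  | one => decide
  | more n ih₀ ih₁ => exact Nat.add_le_add (c := 1) ih₁ (lucas_pos n)

theorem lucas_add_fib (n : ℕ) : lucas n + Nat.fib n = 2 * Nat.fib (n + 1) := by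
  induction n using Nat.twoStepInduction with
  | zero => decide
  | one => decide
  | more n ih₀ ih₁ =>
    have h₂ := Nat.fib_add_two (n := n)
    have h₃ := Nat.fib_add_two (n := n + 1)
    simp only [lucas_add_two, add_assoc, Nat.reduceAdd] at *
    omega

theorem fib_two_mul_eq_fib_mul_lucas (n : ℕ) : Nat.fib (2 * n) = Nat.fib n * lucas n := by
  rw [Nat.fib_two_mul, ← lucas_add_fib, Nat.add_sub_cancel]

theorem dvd_two_of_dvd_fib_of_dvd_lucas {d n : ℕ} (hf : d ∣ Nat.fib n) (hl : d ∣ lucas n) :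
    d ∣ 2 := by
  have h : d ∣ 2 * Nat.fib (n + 1) := lucas_add_fib n ▸ dvd_add hl hf
  exact ((Nat.fib_coprime_fib_succ n).coprime_dvd_left hf).dvd_of_dvd_mul_right h

theorem dvd_of_fib_dvd_fib {m n : ℕ} (hm : 3 ≤ m) (h : Nat.fib m ∣ Nat.fib n) : m ∣ n := by
  have hg : Nat.fib (Nat.gcd m n) = Nat.fib m := by
    rw [Nat.fib_gcd, Nat.gcd_eq_left h]
  by_contra hn
  have hlt : Nat.gcd m n < m :=
    lt_of_le_of_ne (Nat.gcd_le_left n (by omega)) fun he => hn (Nat.gcd_eq_left_iff_dvd.mp he)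
  have h₁ : Nat.fib (Nat.gcd m n) ≤ Nat.fib (m - 1) := Nat.fib_mono (by omega)
  have h₂ : Nat.fib (m - 1) < Nat.fib (m - 1 + 1) := Nat.fib_lt_fib_succ (by omega)
  rw [Nat.sub_add_cancel (by omega)] at h₂
  omega

theorem lucas_mod_periodic {N P : ℕ} (h₀ : lucas P ≡ lucas 0 [MOD N])
    (h₁ : lucas (P + 1) ≡ lucas 1 [MOD N]) : Function.Periodic (fun r => lucas r % N) P := by
  intro r
  change lucas (r + P) ≡ lucas r [MOD N]
  induction r using Nat.twoStepInduction with
  | zero => simpa using h₀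
  | one => simpa [add_comm] using h₁
  | more n ih₀ ih₁ =>
    have h : n + 2 + P = n + P + 2 := by omega
    rw [h, lucas_add_two, lucas_add_two]
    refine Nat.ModEq.add ?_ ih₀
    rwa [show n + P + 1 = n + 1 + P by omega]

theorem pow_mod_periodic {N M a k : ℕ} (h : a ^ (k + M) ≡ a ^ k [MOD N]) :
    Function.Periodic (fun y => a ^ (k + y) % N) M := by
  intro y
  change a ^ (k + (y + M)) ≡ a ^ (k + y) [MOD N]
  rw [show k + (y + M) = k + M + y by omega, pow_add, pow_add a k y]
  exact h.mul_right _

theorem not_eight_dvd_lucas (r : ℕ) : ¬ 8 ∣ lucas r := by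
  have h := (lucas_mod_periodic (N := 8) (P := 12) (by decide) (by decide)).map_mod_nat r
  have key : ∀ s < 12, lucas s % 8 ≠ 0 := by decide
  rw [Nat.dvd_iff_mod_eq_zero]
  exact h ▸ key _ (Nat.mod_lt _ (by norm_num))

theorem not_fib_dvd_lucas {m : ℕ} (hm : 5 ≤ m) (r : ℕ) : ¬ Nat.fib m ∣ lucas r := by
  intro h
  have le_three {k : ℕ} (hk : Nat.fib k ∣ 2) : k ≤ 3 := by
    by_contra! h4
    have h₁ : Nat.fib 4 ≤ Nat.fib k := Nat.fib_mono h4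
    have h₂ := Nat.le_of_dvd two_pos hk
    have h₃ : Nat.fib 4 = 3 := rfl
    omega
  have hdvd : m ∣ 2 * r := dvd_of_fib_dvd_fib (by omega) <| by
    rw [fib_two_mul_eq_fib_mul_lucas]
    exact h.mul_left _
  rcases Nat.even_or_odd' m with ⟨d, rfl | rfl⟩
  · have hd : d ∣ r := Nat.dvd_of_mul_dvd_mul_left two_pos hdvd
    have hd3 := le_three <| dvd_two_of_dvd_fib_of_dvd_lucas (Nat.fib_dvd _ _ hd)
      ((Nat.fib_dvd _ _ (dvd_mul_left d 2)).trans h)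
    obtain rfl : d = 3 := by omega
    exact not_eight_dvd_lucas r h
  · have hr : 2 * d + 1 ∣ r := Nat.Coprime.dvd_of_dvd_mul_left (by simp) hdvd
    have := le_three <| dvd_two_of_dvd_fib_of_dvd_lucas (Nat.fib_dvd _ _ hr) h
    omega

/-- A congruence obstruction modulo `N` to `b ^ x + L r = a ^ x` in the range `k ≤ x`, checked
over one period `M` of the powers and one period `P` of the Lucas numbers. -/
theorem pow_add_lucas_ne_pow {a b k : ℕ} (N P M : ℕ) (hP : 0 < P) (hM : 0 < M)
    (h₀ : lucas P ≡ lucas 0 [MOD N]) (h₁ : lucas (P + 1) ≡ lucas 1 [MOD N])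
    (ha : a ^ (k + M) ≡ a ^ k [MOD N]) (hb : b ^ (k + M) ≡ b ^ k [MOD N])
    (key : ∀ y < M, ∀ s < P,
      (b ^ (k + y) % N + lucas s % N) % N ≠ a ^ (k + y) % N)
    (r : ℕ) {x : ℕ} (hx : k ≤ x) : b ^ x + lucas r ≠ a ^ x := by
  intro h
  obtain ⟨y, rfl⟩ := Nat.exists_eq_add_of_le hx
  have hr := (lucas_mod_periodic h₀ h₁).map_mod_nat r
  have hya := (pow_mod_periodic ha).map_mod_nat y
  have hyb := (pow_mod_periodic hb).map_mod_nat y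
  apply key (y % M) (Nat.mod_lt _ hM) (r % P) (Nat.mod_lt _ hP)
  rw [hr, hya, hyb, ← Nat.add_mod, h]

theorem one_pow_add_lucas_ne_two_pow (r : ℕ) {x : ℕ} (hx : 4 ≤ x) : 1 ^ x + lucas r ≠ 2 ^ x :=
  pow_add_lucas_ne_pow 48 24 4 (by decide) (by decide) (by decide +kernel) (by decide +kernel)
    (by decide +kernel) (by decide +kernel) (by decide +kernel) r hx

theorem two_pow_add_lucas_ne_three_pow (r : ℕ) {x : ℕ} (hx : 2 ≤ x) :
    2 ^ x + lucas r ≠ 3 ^ x :=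
  pow_add_lucas_ne_pow (9 * 25 * 11 * 31 * 61) 120 60 (by decide) (by decide) (by decide +kernel)
    (by decide +kernel) (by decide +kernel) (by decide +kernel) (by decide +kernel) r hx

theorem three_pow_add_lucas_ne_five_pow (r : ℕ) {x : ℕ} (hx : 2 ≤ x) :
    3 ^ x + lucas r ≠ 5 ^ x :=
  pow_add_lucas_ne_pow (8 * 25 * 11) 60 20 (by decide) (by decide) (by decide +kernel)
    (by decide +kernel) (by decide +kernel) (by decide +kernel) (by decide +kernel) r hx

theorem five_pow_add_lucas_ne_eight_pow (r : ℕ) {x : ℕ} (hx : 2 ≤ x) :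
    5 ^ x + lucas r ≠ 8 ^ x :=
  pow_add_lucas_ne_pow (8 * 25 * 11) 60 20 (by decide) (by decide) (by decide +kernel)
    (by decide +kernel) (by decide +kernel) (by decide +kernel) (by decide +kernel) r hx

theorem le_five_of_fib_pow_add_lucas_eq {n r x : ℕ}
    (h : Nat.fib n ^ x + lucas r = Nat.fib (n + 1) ^ x) : n ≤ 5 := by
  by_contra! hn
  obtain ⟨m, rfl⟩ := Nat.exists_eq_add_of_lt hn
  have hd := Nat.sub_dvd_pow_sub_pow (Nat.fib (5 + m + 1 + 1)) (Nat.fib (5 + m + 1)) x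
  rw [← h, Nat.add_sub_cancel_left, Nat.fib_add_two, Nat.add_sub_cancel] at hd
  exact not_fib_dvd_lucas (by omega) r hd

theorem fib_succ_pow_sub_fib_pow_eq_lucas (n r x : ℕ) (hx : 0 < x) :
    (Nat.fib (n + 1) : ℤ) ^ x - (Nat.fib n : ℤ) ^ x = lucas r ↔
      ((n, r) = (0, 1) ∨
        (n, r, x) ∈ ({(2, 1, 1), (2, 2, 2), (2, 4, 3), (4, 0, 1), (3, 1, 1),
          (5, 2, 1)} : Set (ℕ × ℕ × ℕ))) := by
  have hadd : (Nat.fib (n + 1) : ℤ) ^ x - (Nat.fib n : ℤ) ^ x = lucas r ↔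
      Nat.fib n ^ x + lucas r = Nat.fib (n + 1) ^ x := by
    rw [sub_eq_iff_eq_add', eq_comm]
    exact_mod_cast Iff.rfl
  rw [hadd]
  simp only [Set.mem_insert_iff, Set.mem_singleton_iff, Prod.mk.injEq]
  constructor
  · intro h
    have hn := le_five_of_fib_pow_add_lucas_eq h
    have hr := le_lucas r
    interval_cases n <;> norm_num [Nat.fib_add_two] at h ⊢
    · have hl : lucas r = 1 := by simpa [hx.ne'] using h
      have hr1 : r ≤ 1 := hl ▸ hr
      interval_cases r <;> simp_all [lucas]
    · exact (lucas_pos r).ne' h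
    · have hx4 : x < 4 := by
        by_contra! hge
        exact one_pow_add_lucas_ne_two_pow r hge (by rwa [one_pow])
      have hr7 : r ≤ 7 := by interval_cases x <;> omega
      interval_cases x <;> interval_cases r <;> simp_all [lucas]
    · obtain rfl : x = 1 := by
        by_contra hne
        exact two_pow_add_lucas_ne_three_pow r (by omega) h
      have hr3 : r ≤ 3 := by omega
      interval_cases r <;> simp_all [lucas]
    · obtain rfl : x = 1 := by
        by_contra hne
        exact three_pow_add_lucas_ne_five_pow r (by omega) h
      have hr3 : r ≤ 3 := by omega
      interval_cases r <;> simp_all [lucas]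
    · obtain rfl : x = 1 := by
        by_contra hne
        exact five_pow_add_lucas_ne_eight_pow r (by omega) h
      have hr3 : r ≤ 3 := by omega
      interval_cases r <;> simp_all [lucas]
  · rintro (⟨rfl, rfl⟩ | ⟨rfl, rfl, rfl⟩ | ⟨rfl, rfl, rfl⟩ | ⟨rfl, rfl, rfl⟩ | ⟨rfl, rfl, rfl⟩ |
      ⟨rfl, rfl, rfl⟩ | ⟨rfl, rfl, rfl⟩)
    · simp [lucas, hx.ne']
    all_goals decide
end

section
/- All solutions (n, r, x) in nonnegative integers n, r with x a positive integer of the Diophantine equation F_{n+2}^x − F_n^x = L_r are (n,r,x) = (0,1,x) for arbitrary x ≥ 1, together with (1,1,1), (1,2,2), (1,4,3), (2,0,1), and (3,2,1). -/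
theorem lucas_add (k m : ℕ) :
    lucas (k + (m + 1)) = Nat.fib (m + 1) * lucas (k + 1) + Nat.fib m * lucas k := by
  induction m generalizing k with
  | zero => simp
  | succ m ih =>
    rw [show k + (m + 1 + 1) = k + 1 + (m + 1) by ring, ih (k + 1), Nat.fib_add_two,
      show lucas (k + 1 + 1) = lucas (k + 1) + lucas k from rfl]
    ring

theorem lucas_pos_and_le (r : ℕ) : 0 < lucas r ∧ r ≤ lucas r := by
  induction r using Nat.twoStepInduction with
  | zero => decide
  | one => decide
  | more k h₀ h₁ =>
    rw [lucas]
    rcases k with _ | k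
    · decide
    · omega

theorem lucas_succ_eq_fib (r : ℕ) : lucas (r + 1) = Nat.fib (r + 2) + Nat.fib r := by
  have h := lucas_add 0 r
  have h₂ := Nat.fib_add_two (n := r)
  simp only [Nat.zero_add, lucas] at h
  omega

theorem lucas_four_mul_add_two (k : ℕ) : lucas (4 * k) + 2 = lucas (2 * k) ^ 2 := by
  have cassini (k : ℕ) : (lucas (k + 1) : ℤ) ^ 2 - lucas (k + 1) * lucas k - lucas k ^ 2 =
      -5 * (-1) ^ k := by
    induction k with
    | zero => decide
    | succ k ih =>
      rw [lucas]
      push_cast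
      linear_combination -ih
  rcases k with _ | k
  · decide
  have h := lucas_add (2 * k + 2) (2 * k + 1)
  have hf := lucas_succ_eq_fib (2 * k + 1)
  have hf' := lucas_succ_eq_fib (2 * k + 2)
  have h₂ := Nat.fib_add_two (n := 2 * k + 1)
  have h₃ := Nat.fib_add_two (n := 2 * k + 2)
  have hc := cassini (2 * k + 2)
  rw [show (-1 : ℤ) ^ (2 * k + 2) = 1 from Even.neg_one_pow ⟨k + 1, by ring⟩] at hc
  rw [show 4 * (k + 1) = 2 * k + 2 + (2 * k + 1 + 1) by ring, show 2 * (k + 1) = 2 * k + 2 by ring,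
    h]
  simp only [Nat.add_assoc, Nat.reduceAdd] at *
  zify at *
  generalize (lucas (2 * k + 2) : ℤ) = a at *
  generalize (lucas (2 * k + 3) : ℤ) = b at *
  generalize (Nat.fib (2 * k + 2) : ℤ) = u at *
  generalize (Nat.fib (2 * k + 1) : ℤ) = v at *
  have ha : a = u + 2 * v := by linarith
  have hb : b = 3 * u + v := by linarith
  subst ha hb
  linarith

theorem lucas_mod_144 (r : ℕ) : lucas r % 144 = lucas (r % 24) % 144 := by
  induction r using Nat.strong_induction_on with
  | _ r ih =>
    rcases lt_or_ge r 24 with h | h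
    · rw [Nat.mod_eq_of_lt h]
    · obtain ⟨k, rfl⟩ := Nat.exists_eq_add_of_le' h
      have hk := ih k (by omega)
      have := lucas_add k 23
      norm_num [Nat.fib_add_two] at this
      rw [Nat.add_mod_right]
      omega

theorem two_pow_ne_sq_sub_one {a x : ℕ} (hx : 4 ≤ x) : 2 ^ x + 1 ≠ a ^ 2 := by
  intro h
  have h16 : 2 ^ 4 ≤ 2 ^ x := Nat.pow_le_pow_right (by norm_num) hx
  have ha : 4 < a := by nlinarith
  obtain ⟨b, rfl⟩ := Nat.exists_eq_add_of_le' (show 1 ≤ a by omega)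
  have hb : b * (b + 2) = 2 ^ x := by nlinarith
  obtain ⟨i, -, hi⟩ := (Nat.dvd_prime_pow Nat.prime_two).1 (Dvd.intro _ hb)
  obtain ⟨j, -, hj⟩ := (Nat.dvd_prime_pow Nat.prime_two).1 (Dvd.intro_left _ hb)
  rcases i with _ | _ | i
  · omega
  · omega
  rcases j with _ | _ | j
  · omega
  · omega
  rw [pow_succ, pow_succ] at hi hj
  omega

theorem two_pow_ne_lucas_add_one {x : ℕ} (hx : 4 ≤ x) (r : ℕ) : 2 ^ x ≠ lucas r + 1 := by
  intro h
  have h₀ : r % 4 ≠ 0 := by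
    intro hr
    obtain ⟨k, rfl⟩ := Nat.dvd_of_mod_eq_zero hr
    have := lucas_four_mul_add_two k
    exact two_pow_ne_sq_sub_one hx (a := lucas (2 * k)) (by omega)
  have h₁ : 2 ^ x % 16 = 0 := Nat.mod_eq_zero_of_dvd (pow_dvd_pow 2 hx)
  have h₂ : 2 ^ x % 3 ≠ 0 := fun h3 => by
    have := Nat.prime_three.dvd_of_dvd_pow (Nat.dvd_of_mod_eq_zero h3)
    omega
  have hm := lucas_mod_144 r
  have hr : r % 24 < 24 := Nat.mod_lt _ (by norm_num)
  generalize hs : r % 24 = s at *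
  interval_cases s <;> simp only [lucas] at hm <;> omega

theorem three_pow_ne_lucas_add_one {x : ℕ} (hx : 2 ≤ x) (r : ℕ) : 3 ^ x ≠ lucas r + 1 := by
  intro h
  have h₁ : 3 ^ x % 9 = 0 := Nat.mod_eq_zero_of_dvd (pow_dvd_pow 3 hx)
  have h₂ : 3 ^ x % 2 = 1 := Nat.odd_iff.1 (Odd.pow (by decide))
  have hm := lucas_mod_144 r
  have hr : r % 24 < 24 := Nat.mod_lt _ (by norm_num)
  generalize hs : r % 24 = s at *
  interval_cases s <;> simp only [lucas] at hm <;> omega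

theorem five_pow_ne_lucas_add_two_pow {x : ℕ} (hx : 2 ≤ x) (r : ℕ) :
    5 ^ x ≠ lucas r + 2 ^ x := by
  intro h
  have h₁ : 2 ^ x % 4 = 0 := Nat.mod_eq_zero_of_dvd (pow_dvd_pow 2 hx)
  have h₂ : 5 ^ x % 4 = 1 := by simp [Nat.pow_mod]
  have h₃ : 5 ^ x % 3 = 2 ^ x % 3 := Nat.pow_mod 5 x 3
  have hm := lucas_mod_144 r
  have hr : r % 24 < 24 := Nat.mod_lt _ (by norm_num)
  generalize hs : r % 24 = s at *
  interval_cases s <;> simp only [lucas] at hm <;> omega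

theorem fib_add_two_pow_sub_fib_pow_eq_lucas (n r x : ℕ) (hx : 0 < x) :
    (Nat.fib (n + 2) : ℤ) ^ x - (Nat.fib n : ℤ) ^ x = lucas r ↔
      ((n, r) = (0, 1) ∨
        (n, r, x) ∈ ({(1, 1, 1), (1, 2, 2), (1, 4, 3), (2, 0, 1),
          (3, 2, 1)} : Set (ℕ × ℕ × ℕ))) := by
  simp only [Set.mem_insert_iff, Set.mem_singleton_iff, Prod.mk.injEq]
  constructor
  · intro h
    have hn : n < 4 := by
      by_contra! hn
      refine not_fib_dvd_lucas (show 5 ≤ n + 1 by omega) r ?_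
      have hd := sub_dvd_pow_sub_pow (Nat.fib (n + 2) : ℤ) (Nat.fib n) x
      rw [h, Nat.fib_add_two, Nat.cast_add, add_sub_cancel_left] at hd
      exact_mod_cast hd
    have hN : Nat.fib (n + 2) ^ x = lucas r + Nat.fib n ^ x := by
      zify
      linarith
    have hle := (lucas_pos_and_le r).2
    interval_cases n <;> norm_num [Nat.fib_add_two, hx.ne'] at hN
    · have hr : r ≤ 1 := by omega
      interval_cases r
      · simp [lucas] at hN
      · simp
    · have hx4 : x < 4 := by
        by_contra! hx4
        exact two_pow_ne_lucas_add_one hx4 r hN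
      have hr : r ≤ 7 := by interval_cases x <;> omega
      interval_cases x <;> interval_cases r <;> simp_all [lucas]
    · have hx2 : x < 2 := by
        by_contra! hx2
        exact three_pow_ne_lucas_add_one hx2 r hN
      obtain rfl : x = 1 := by omega
      have hr : r ≤ 2 := by omega
      interval_cases r <;> simp_all [lucas]
    · have hx2 : x < 2 := by
        by_contra! hx2
        exact five_pow_ne_lucas_add_two_pow hx2 r hN
      obtain rfl : x = 1 := by omega
      have hr : r ≤ 3 := by omega
      interval_cases r <;> simp_all [lucas]
  · rintro (⟨rfl, rfl⟩ | ⟨rfl, rfl, rfl⟩ | ⟨rfl, rfl, rfl⟩ | ⟨rfl, rfl, rfl⟩ | ⟨rfl, rfl, rfl⟩ |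
      ⟨rfl, rfl, rfl⟩) <;> norm_num [Nat.fib_add_two, lucas, hx.ne']
end

section
/- The Diophantine equation 3^x − 2^x = L_r in nonnegative integers r, x has only the solution (r, x) = (1, 1). -/
/-- If the Lucas sequence returns to its initial values modulo `m` after `p` steps, then it is
periodic modulo `m` with period `p`. -/
theorem lucas_periodic_mod {m p : ℕ} (h₀ : lucas p ≡ 2 [MOD m]) (h₁ : lucas (p + 1) ≡ 1 [MOD m]) :
    Function.Periodic (fun n => lucas n % m) p := by
  intro n
  change lucas (n + p) ≡ lucas n [MOD m]
  induction n using Nat.twoStepInduction with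
  | zero => simpa [lucas] using h₀
  | one => simpa [lucas, add_comm] using h₁
  | more n ih₀ ih₁ =>
    rw [show n + 2 + p = n + p + 2 by omega, lucas, lucas, show n + p + 1 = n + 1 + p by omega]
    exact ih₁.add ih₀

theorem mul_pow_periodic_mod {m p c a : ℕ} (h : c * a ^ p ≡ c [MOD m]) :
    Function.Periodic (fun n => c * a ^ n % m) p := by
  intro n
  change c * a ^ (n + p) ≡ c * a ^ n [MOD m]
  rw [add_comm, pow_add, ← mul_assoc]
  exact h.mul_right (a ^ n)

theorem modEq_of_three_pow_eq_lucas_add_two_pow {m p r y : ℕ}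
    (h : 9 * 3 ^ y = lucas r + 4 * 2 ^ y)
    (h₀ : lucas p ≡ 2 [MOD m]) (h₁ : lucas (p + 1) ≡ 1 [MOD m])
    (h₃ : 9 * 3 ^ p ≡ 9 [MOD m]) (h₂ : 4 * 2 ^ p ≡ 4 [MOD m]) :
    9 * 3 ^ (y % p) ≡ lucas (r % p) + 4 * 2 ^ (y % p) [MOD m] :=
  ((mul_pow_periodic_mod h₃).map_mod_nat y).trans ((congrArg (· % m) h).trans
    (Nat.ModEq.add ((lucas_periodic_mod h₀ h₁).map_mod_nat r)
      ((mul_pow_periodic_mod h₂).map_mod_nat y)).symm)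

/-- All sequences involved have period `24` modulo `180 = 4 * 9 * 5` and period `120` modulo
`153511380 = 180 * 11 * 31 * 41 * 61`. The first modulus leaves few residue classes, and the second
excludes them. -/
theorem three_pow_ne_lucas_add_two_pow (r y : ℕ) : 9 * 3 ^ y ≠ lucas r + 4 * 2 ^ y := by
  intro h
  have no_residues : ∀ s < 24, ∀ z < 24, 9 * 3 ^ z ≡ lucas s + 4 * 2 ^ z [MOD 180] →
      ∀ i < 5, ∀ j < 5,
        ¬ 9 * 3 ^ (z + 24 * j) ≡ lucas (s + 24 * i) + 4 * 2 ^ (z + 24 * j) [MOD 153511380] := by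
    decide +kernel
  refine no_residues (r % 24) (by omega) (y % 24) (by omega)
    (modEq_of_three_pow_eq_lucas_add_two_pow h (by decide +kernel) (by decide +kernel)
      (by decide +kernel) (by decide +kernel))
    (r / 24 % 5) (by omega) (y / 24 % 5) (by omega) ?_
  rw [show r % 24 + 24 * (r / 24 % 5) = r % 120 by omega,
    show y % 24 + 24 * (y / 24 % 5) = y % 120 by omega]
  exact modEq_of_three_pow_eq_lucas_add_two_pow h (by decide +kernel) (by decide +kernel)
    (by decide +kernel) (by decide +kernel)

theorem one_lt_lucas_add_two (n : ℕ) : 1 < lucas (n + 2) := by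
  rw [lucas]
  have := lucas_pos n
  have := lucas_pos (n + 1)
  omega

theorem three_pow_sub_two_pow_eq_lucas (r x : ℕ) :
    (3 : ℤ) ^ x - 2 ^ x = lucas r ↔ (r, x) = (1, 1) := by
  constructor
  · intro h
    match x with
    | 0 =>
      have := lucas_pos r
      norm_num at h
      omega
    | 1 =>
      norm_num at h
      match r with
      | 0 => simp [lucas] at h
      | 1 => rfl
      | n + 2 =>
        have := one_lt_lucas_add_two n
        omega
    | y + 2 =>
      refine absurd ?_ (three_pow_ne_lucas_add_two_pow r y)
      zify
      rw [← h]
      ring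
  · rintro ⟨⟩
    norm_num [lucas]
end

section
/- The Diophantine equation 8^x − 5^x = L_r in nonnegative integers r, x has only the solution (r, x) = (2, 1). -/
theorem lucas_eq_three_iff (r : ℕ) : lucas r = 3 ↔ r = 2 := by
  constructor
  · intro h
    match r with
    | 0 | 1 => simp [lucas] at h
    | 2 => rfl
    | 3 => simp [lucas] at h
    | n + 4 =>
      have h₀ := lucas_pos n
      have h₁ := lucas_pos (n + 1)
      simp only [lucas] at h
      omega
  · rintro rfl
    rfl

theorem lucas_add_period_modEq (n : ℕ) : lucas (n + 48) ≡ lucas n [MOD 5040] := by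
  induction n using Nat.twoStepInduction with
  | zero => decide +kernel
  | one => decide +kernel
  | more n h₀ h₁ => exact h₁.add h₀

theorem lucas_mod_modEq (n : ℕ) : lucas (n % 48) ≡ lucas n [MOD 5040] :=
  Function.Periodic.map_mod_nat (f := fun n => lucas n % 5040) lucas_add_period_modEq n

theorem pow_add_two_mod_modEq {a : ℕ} (h : a ^ 14 ≡ a ^ 2 [MOD 5040]) (k : ℕ) :
    a ^ (k % 12 + 2) ≡ a ^ (k + 2) [MOD 5040] := by
  refine Function.Periodic.map_mod_nat (f := fun k => a ^ (k + 2) % 5040) (fun k => ?_) k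
  have := h.mul_left (a ^ k)
  rwa [← pow_add, ← pow_add] at this

/-- Modulo `5040 = 144 * 105` there is no solution with exponent at least two. -/
theorem lucas_add_five_pow_ne_eight_pow (r k : ℕ) :
    lucas r + 5 ^ (k + 2) ≠ 8 ^ (k + 2) := by
  intro h
  have residues : ∀ n < 48, ∀ m < 12,
      ¬ lucas n + 5 ^ (m + 2) ≡ 8 ^ (m + 2) [MOD 5040] := by
    decide +kernel
  refine residues (r % 48) (Nat.mod_lt _ (by norm_num)) (k % 12) (Nat.mod_lt _ (by norm_num)) ?_
  calc lucas (r % 48) + 5 ^ (k % 12 + 2)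
      ≡ lucas r + 5 ^ (k + 2) [MOD 5040] :=
        (lucas_mod_modEq r).add (pow_add_two_mod_modEq (by decide) k)
    _ = 8 ^ (k + 2) := h
    _ ≡ 8 ^ (k % 12 + 2) [MOD 5040] := (pow_add_two_mod_modEq (by decide) k).symm

theorem eight_pow_sub_five_pow_eq_lucas (r x : ℕ) :
    (8 : ℤ) ^ x - 5 ^ x = lucas r ↔ (r, x) = (2, 1) := by
  rw [Prod.mk.injEq]
  match x with
  | 0 =>
    have := lucas_pos r
    simp
    omega
  | 1 =>
    rw [← lucas_eq_three_iff]
    norm_num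
    omega
  | k + 2 =>
    have h := lucas_add_five_pow_ne_eight_pow r k
    refine iff_of_false (fun e => h ?_) (by omega)
    zify
    linarith
end

section
/- The Diophantine equation 3^x − 1 = L_r in nonnegative integers r, x has only the solution (r, x) = (0, 1). -/
/-- The Lucas sequence modulo 18 has period 24. -/
theorem lucas_mod_eighteen_periodic : Function.Periodic (fun n => lucas n % 18) 24 := by
  intro n
  have h : lucas (n + 24) = 46368 * lucas (n + 1) + 28657 * lucas n := by
    simp only [lucas_add_two]
    ring
  simp only [h]
  omega

theorem lucas_mod_eighteen_ne_eight (n : ℕ) : lucas n % 18 ≠ 8 := by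
  have h : ∀ m < 24, lucas m % 18 ≠ 8 := by decide
  rw [← lucas_mod_eighteen_periodic.map_mod_nat n]
  exact h _ (Nat.mod_lt _ (by norm_num))

theorem two_lt_lucas_add_two (n : ℕ) : 2 < lucas (n + 2) := by
  induction n with
  | zero => simp [lucas]
  | succ n ih =>
    rw [lucas_add_two (n + 1)]
    exact ih.trans_le (Nat.le_add_right _ _)

theorem lucas_eq_two_iff {n : ℕ} : lucas n = 2 ↔ n = 0 := by
  match n with
  | 0 => simp [lucas]
  | 1 => simp [lucas]
  | n + 2 => simpa using (two_lt_lucas_add_two n).ne'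

theorem three_pow_sub_one_eq_lucas (r x : ℕ) :
    (3 : ℤ) ^ x - 1 = lucas r ↔ (r, x) = (0, 1) := by
  constructor
  · intro h
    match x with
    | 0 =>
      have := lucas_pos r
      omega
    | 1 =>
      have : r = 0 := lucas_eq_two_iff.mp (by omega)
      rw [this]
    | y + 2 =>
      have hodd : (3 : ℤ) ^ y % 2 = 1 := Int.odd_iff.mp (Odd.pow (by decide))
      have := lucas_mod_eighteen_ne_eight r
      rw [pow_add] at h
      omega
  · rintro ⟨⟩
    simp [lucas]
end

section
/- If m, n, r, x are integers with m ≥ 1, n ≥ 4, m < n, x ≥ 2, r ≥ 0, and F_n^x − F_m^x = L_r, then (n−3)·x ≤ r < n·x. -/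
open Real in
theorem Nat.fib_succ_le_goldenRatio_pow (n : ℕ) : (Nat.fib (n + 1) : ℝ) ≤ goldenRatio ^ n := by
  induction n using Nat.twoStepInduction with
  | zero => simp
  | one => simpa using one_lt_goldenRatio.le
  | more n h₁ h₂ =>
    rw [Nat.fib_add_two, pow_add, goldenRatio_sq]
    push_cast
    rw [pow_succ] at h₂
    linarith

open Real in
theorem Nat.goldenRatio_pow_le_fib (n : ℕ) : goldenRatio ^ n ≤ (Nat.fib (n + 2) : ℝ) := by
  induction n using Nat.twoStepInduction with
  | zero => simp
  | one => simpa [Nat.fib_add_two] using goldenRatio_lt_two.le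
  | more n h₁ h₂ =>
    rw [Nat.fib_add_two, pow_add, goldenRatio_sq]
    push_cast
    rw [pow_succ] at h₂
    linarith

open Real in
theorem lucas_succ_lt_goldenRatio_pow (n : ℕ) : (lucas (n + 1) : ℝ) < goldenRatio ^ (n + 2) := by
  have h_one := one_lt_goldenRatio
  have h_sq := goldenRatio_sq
  induction n using Nat.twoStepInduction with
  | zero => simp only [lucas, zero_add, h_sq, Nat.cast_one]; linarith
  | one => norm_num [lucas]; nlinarith
  | more n h₁ h₂ =>
    rw [show lucas (n + 2 + 1) = lucas (n + 1 + 1) + lucas (n + 1) from rfl,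
      pow_add _ (n + 2), h_sq]
    push_cast
    rw [show n + 1 + 2 = (n + 2) + 1 by ring, pow_succ] at h₂
    linarith

open Real in
theorem goldenRatio_pow_le_mul_lucas (n : ℕ) : goldenRatio ^ n ≤ goldenRatio * lucas n := by
  induction n using Nat.twoStepInduction with
  | zero => norm_num [lucas]
  | one => norm_num [lucas]
  | more n h₁ h₂ =>
    rw [show lucas (n + 2) = lucas (n + 1) + lucas n from rfl, pow_add, goldenRatio_sq]
    push_cast
    rw [pow_succ] at h₂
    linarith

theorem sub_mul_pow_le_pow_succ_sub_pow_succ {a b : ℝ} (hb : 0 ≤ b) (hab : b ≤ a) (k : ℕ) :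
    (a - b) * a ^ k ≤ a ^ (k + 1) - b ^ (k + 1) := by
  have := mul_le_mul_of_nonneg_left (pow_le_pow_left₀ hb hab k) hb
  rw [pow_succ, pow_succ]
  linarith

open Real in
theorem r_bounds (m n r x : ℕ) (hm : 1 ≤ m) (hn : 4 ≤ n) (hmn : m < n) (hx : 2 ≤ x)
    (h : (Nat.fib n : ℤ) ^ x - (Nat.fib m : ℤ) ^ x = lucas r) :
    (n - 3) * x ≤ r ∧ r < n * x := by
  have h_one := one_lt_goldenRatio
  have h_real : (Nat.fib n : ℝ) ^ x - (Nat.fib m : ℝ) ^ x = lucas r := by exact_mod_cast h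
  obtain ⟨k, rfl⟩ : ∃ k, n = k + 4 := ⟨n - 4, by omega⟩
  obtain ⟨y, rfl⟩ : ∃ y, x = y + 2 := ⟨x - 2, by omega⟩
  constructor
  · by_contra! hr
    have h_lucas : (lucas r : ℝ) < goldenRatio ^ ((k + 1) * (y + 2)) := by
      rw [show k + 4 - 3 = k + 1 by omega] at hr
      cases r with
      | zero =>
        calc ((lucas 0 : ℕ) : ℝ) < goldenRatio ^ 2 := by
              rw [goldenRatio_sq]; norm_num [lucas]; linarith
          _ ≤ _ := pow_le_pow_right₀ h_one.le (by nlinarith)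
      | succ s =>
        exact (lucas_succ_lt_goldenRatio_pow s).trans_le (pow_le_pow_right₀ h_one.le hr)
    have h_mono : (Nat.fib m : ℝ) ≤ Nat.fib (k + 3) := by
      exact_mod_cast Nat.fib_mono (by omega)
    have h_sub : (Nat.fib (k + 4) : ℝ) - Nat.fib (k + 3) = Nat.fib (k + 2) := by
      rw [Nat.fib_add_two (n := k + 2)]; push_cast; ring
    have h_le : (Nat.fib (k + 3) : ℝ) ≤ Nat.fib (k + 4) := by
      exact_mod_cast Nat.fib_mono (by omega)
    have h_diff := sub_mul_pow_le_pow_succ_sub_pow_succ (Nat.cast_nonneg _) h_le (y + 1)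
    rw [h_sub] at h_diff
    have h_pow : (Nat.fib m : ℝ) ^ (y + 2) ≤ (Nat.fib (k + 3) : ℝ) ^ (y + 2) := by gcongr
    have h_lower : goldenRatio ^ ((k + 1) * (y + 2)) ≤
        (Nat.fib (k + 2) : ℝ) * (Nat.fib (k + 4) : ℝ) ^ (y + 1) :=
      calc goldenRatio ^ ((k + 1) * (y + 2))
          ≤ goldenRatio ^ (k + (k + 2) * (y + 1)) := pow_le_pow_right₀ h_one.le (by nlinarith)
        _ = goldenRatio ^ k * (goldenRatio ^ (k + 2)) ^ (y + 1) := by rw [pow_add, pow_mul]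
        _ ≤ _ := by
          gcongr
          · exact Nat.goldenRatio_pow_le_fib k
          · exact Nat.goldenRatio_pow_le_fib (k + 2)
    linarith
  · have h_fib_pos : (0 : ℝ) < (Nat.fib m : ℝ) ^ (y + 2) := by
      have := Nat.fib_pos.2 hm
      positivity
    have h_upper : goldenRatio ^ r < goldenRatio ^ ((k + 3) * (y + 2) + 1) :=
      calc goldenRatio ^ r ≤ goldenRatio * lucas r := goldenRatio_pow_le_mul_lucas r
        _ < goldenRatio * (Nat.fib (k + 4) : ℝ) ^ (y + 2) := by gcongr; linarith
        _ ≤ goldenRatio * (goldenRatio ^ (k + 3)) ^ (y + 2) := by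
          gcongr
          exact Nat.fib_succ_le_goldenRatio_pow (k + 3)
        _ = _ := by rw [← pow_mul, pow_succ, mul_comm]
    have := (pow_lt_pow_iff_right₀ h_one).1 h_upper
    nlinarith
end

section
/- If m, n, r, x are integers with m ≥ 1, n ≥ 4, m < n, x ≥ 2, r ≥ 0, and F_n^x − F_m^x = L_r, then |1 − F_n^{−x}·α^r| < 2/(1.5)^x, where α = (1 + √5)/2 is the golden ratio. -/
open Real in
theorem lucas_eq_goldenRatio_pow_add_goldenConj_pow (n : ℕ) :
    (lucas n : ℝ) = goldenRatio ^ n + goldenConj ^ n := by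
  induction n using Nat.twoStepInduction with
  | zero => norm_num [lucas]
  | one => simp [lucas, goldenRatio_add_goldenConj]
  | more n ih₀ ih₁ =>
    rw [lucas, Nat.cast_add, ih₀, ih₁, pow_add goldenRatio n 2, pow_add goldenConj n 2,
      goldenRatio_sq, goldenConj_sq]
    ring

theorem three_mul_fib_le_two_mul_fib {m n : ℕ} (hn : 4 ≤ n) (hmn : m < n) :
    3 * Nat.fib m ≤ 2 * Nat.fib n := by
  obtain ⟨k, rfl⟩ := Nat.exists_eq_add_of_le' hn
  have hmono : Nat.fib m ≤ Nat.fib (k + 3) := Nat.fib_mono (by lia)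
  have h₄ : Nat.fib (k + 4) = Nat.fib (k + 2) + Nat.fib (k + 3) := Nat.fib_add_two
  have h₃ : Nat.fib (k + 3) = Nat.fib (k + 1) + Nat.fib (k + 2) := Nat.fib_add_two
  have h₂ : Nat.fib (k + 1) ≤ Nat.fib (k + 2) := Nat.fib_le_fib_succ
  lia

theorem linear_form_bound (m n r x : ℕ) (hm : 1 ≤ m) (hn : 4 ≤ n) (hmn : m < n)
    (hx : 2 ≤ x) (h : (Nat.fib n : ℤ) ^ x - (Nat.fib m : ℤ) ^ x = lucas r) :
    |1 - (Nat.fib n : ℝ) ^ (-(x : ℤ)) * ((1 + Real.sqrt 5) / 2) ^ r| <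
      2 / (1.5 : ℝ) ^ x := by
  change |1 - (Nat.fib n : ℝ) ^ (-(x : ℤ)) * Real.goldenRatio ^ r| < 2 / (1.5 : ℝ) ^ x
  have hF : (3 : ℝ) ≤ Nat.fib n := by
    exact_mod_cast (Nat.fib_mono hn : Nat.fib 4 ≤ Nat.fib n)
  have hratio : (1.5 : ℝ) * Nat.fib m ≤ Nat.fib n := by
    have : (3 : ℝ) * Nat.fib m ≤ 2 * Nat.fib n := by
      exact_mod_cast three_mul_fib_le_two_mul_fib hn hmn
    linarith
  have hL : (Nat.fib n : ℝ) ^ x - (Nat.fib m : ℝ) ^ x =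
      Real.goldenRatio ^ r + Real.goldenConj ^ r := by
    rw [← lucas_eq_goldenRatio_pow_add_goldenConj_pow]
    exact_mod_cast h
  have hψ : |Real.goldenConj ^ r| ≤ 1 := by
    rw [abs_pow]
    exact pow_le_one₀ (abs_nonneg _)
      (abs_le.2 ⟨Real.neg_one_lt_goldenConj.le, by linarith [Real.goldenConj_neg]⟩)
  have hFx : (0 : ℝ) < (Nat.fib n : ℝ) ^ x := by positivity
  have hsmall : (1.5 : ℝ) ^ x * (Nat.fib m : ℝ) ^ x ≤ (Nat.fib n : ℝ) ^ x := by
    rw [← mul_pow]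
    gcongr
  have hlt : (1.5 : ℝ) ^ x < (Nat.fib n : ℝ) ^ x :=
    pow_lt_pow_left₀ (by linarith) (by norm_num) (by lia)
  have hform : 1 - (Nat.fib n : ℝ) ^ (-(x : ℤ)) * Real.goldenRatio ^ r =
      ((Nat.fib m : ℝ) ^ x + Real.goldenConj ^ r) / (Nat.fib n : ℝ) ^ x := by
    rw [zpow_neg, zpow_natCast, eq_div_iff hFx.ne', sub_mul, mul_right_comm,
      inv_mul_cancel₀ hFx.ne']
    linarith
  rw [hform, abs_div, abs_of_pos hFx, div_lt_div_iff₀ hFx (by positivity)]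
  calc |(Nat.fib m : ℝ) ^ x + Real.goldenConj ^ r| * (1.5 : ℝ) ^ x
      ≤ ((Nat.fib m : ℝ) ^ x + 1) * (1.5 : ℝ) ^ x := by
        gcongr
        refine (abs_add_le _ _).trans ?_
        rw [abs_of_nonneg (by positivity : (0 : ℝ) ≤ (Nat.fib m : ℝ) ^ x)]
        gcongr
    _ < 2 * (Nat.fib n : ℝ) ^ x := by linarith
end
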